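/- Let α, β, γ be integers with β > 0, γ ≠ 0, and γ ≠ −1. Then α + 1/(β + 1/γ) = E([α, 1, 0, 1, 0, …, 0, 1, γ]), where the 2β−1 entries between α and γ alternate 1, 0, 1, …, 0, 1; and α + 1/(β + 1/γ) = E([α+1, m₁, m₂, …, m_{β−1}, (−1)^β(γ+1)]), where m_i = 2·(−1)^i for 1 ≤ i ≤ β−1 (so the middle entries alternate −2, 2, −2, …). In both identities the continued fraction values are well defined. -/

import Mathlib

/-- Continued fraction value of a list of integers (junk value `0` on `[]`,
division by zero yields junk, as usual in Lean). -/
def E : List ℤ → ℚ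
  | [] => 0
  | [q] => (q : ℚ)
  | q :: l => (q : ℚ) + 1 / E l

/-- The continued fraction value of the list is well defined: the list is
nonempty and no division by zero occurs in the evaluation of `E`. -/
def EWellDef : List ℤ → Prop
  | [] => False
  | [_] => True
  | _ :: l => EWellDef l ∧ E l ≠ 0

/-- Membership in `A₀`: `[q₀,…,q_r]` with `q_i ≠ 0` for `1 ≤ i ≤ r` and
`E([q_i,…,q_r]) ≠ 0` for `0 < i < r`. -/
def memA0 (l : List ℤ) : Prop :=
  l ≠ [] ∧ (∀ i, 0 < i → i < l.length → l.getD i 0 ≠ 0) ∧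
    ∀ i, 0 < i → i + 1 < l.length → E (l.drop i) ≠ 0

/-- Membership in `A₁`: member of `A₀` with `q_i ≥ 1` for `0 < i < r` and
`q_r > 1` when `r > 0`. -/
def memA1 (l : List ℤ) : Prop :=
  memA0 l ∧ (∀ i, 0 < i → i + 1 < l.length → 1 ≤ l.getD i 0) ∧
    (1 < l.length → 1 < l.getD (l.length - 1) 0)

/-- Membership in `A₂`: member of `A₀` with `|q_i| > 1` for `0 < i ≤ r`. -/
def memA2 (l : List ℤ) : Prop :=
  memA0 l ∧ ∀ i, 0 < i → i < l.length → 1 < |l.getD i 0|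

/-- Euclidean-algorithm computation of the short continued fraction of `a/b`. -/
def scfAux (a : ℤ) (b : ℕ) : List ℤ :=
  if hb : b = 0 then []
  else
    have h0 : 0 ≤ Int.emod a (b : ℤ) := Int.emod_nonneg a (by exact_mod_cast hb)
    have h1 : Int.emod a (b : ℤ) < (b : ℤ) :=
      Int.emod_lt_of_pos a (by exact_mod_cast Nat.pos_of_ne_zero hb)
    if hr : (Int.emod a (b : ℤ)).toNat = 0 then [Int.ediv a (b : ℤ)]
    else Int.ediv a (b : ℤ) :: scfAux (b : ℤ) (Int.emod a (b : ℤ)).toNat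
  termination_by b
  decreasing_by omega

/-- `C x` is the short continued fraction representation of the rational `x`,
i.e. the unique list in `A₁` whose continued fraction value is `x`. -/
def C (x : ℚ) : List ℤ := scfAux x.num x.den

/-- Entrywise negation of a list. -/
def negL (l : List ℤ) : List ℤ := l.map (fun q => -q)

/-- The operation `⊕` on lists. -/
def oplus (a b : List ℤ) : List ℤ :=
  match b with
  | [] => a
  | p :: ps =>
    if p = 0 then a.dropLast ++ (a.getLastD 0 + ps.headD 0) :: ps.tail
    else a ++ (p :: ps)

/-- The function `f : A₁ → A₂`. -/
def f (l : List ℤ) : List ℤ :=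
  if h : (l.tail.dropLast).findIdx (fun q => q == 1) < l.tail.dropLast.length then
    let j := (l.tail.dropLast).findIdx (fun q => q == 1) + 1
    oplus (l.take (j - 1) ++ [l.getD (j - 1) 0 + 1])
      (negL (f ((l.getD (j + 1) 0 + 1) :: l.drop (j + 2))))
  else l
  termination_by l.length
  decreasing_by
    simp only [List.length_dropLast, List.length_tail, List.length_cons,
      List.length_drop] at h ⊢
    omega

/-- The function `g : A₂ → A₁`. -/
def g (l : List ℤ) : List ℤ :=
  if h : (l.tail).findIdx (fun q => decide (q < 0)) < l.tail.length then
    let j := (l.tail).findIdx (fun q => decide (q < 0)) + 1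
    oplus (l.take (j - 1) ++ [l.getD (j - 1) 0 - 1, 1])
      (g (negL ((l.getD j 0 + 1) :: l.drop (j + 1))))
  else l
  termination_by l.length
  decreasing_by
    simp only [negL, List.length_map, List.length_cons, List.length_drop,
      List.length_tail] at h ⊢
    omega

/-- `[q₀,…,q_r]` satisfies the `(u,v)`-divisibility property: `v ∣ q_i` for even
`i` and `u ∣ q_i` for odd `i`. -/
def DivProp (u v : ℤ) (l : List ℤ) : Prop :=
  ∀ i, i < l.length → (i % 2 = 0 → v ∣ l.getD i 0) ∧ (i % 2 = 1 → u ∣ l.getD i 0)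


theorem E_cons {l : List ℤ} (hl : l ≠ []) (q : ℤ) : E (q :: l) = (q : ℚ) + 1 / E l := by
  cases l with
  | nil => exact absurd rfl hl
  | cons a t => rfl

theorem EWellDef.ne_nil {l : List ℤ} (h : EWellDef l) : l ≠ [] := by
  rintro rfl
  exact h

theorem EWellDef.cons {l : List ℤ} (h : EWellDef l) (h0 : E l ≠ 0) (q : ℤ) :
    EWellDef (q :: l) := by
  cases l with
  | nil => exact absurd rfl h.ne_nil
  | cons a t => exact ⟨h, h0⟩

theorem natCast_mul_add_one_ne_zero {γ : ℤ} (hγ : γ ≠ -1) (n : ℕ) :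
    (n : ℚ) * γ + 1 ≠ 0 := by
  intro h
  have h' : γ * (n : ℤ) = -1 := by
    have : (n : ℤ) * γ + 1 = 0 := by exact_mod_cast h
    linarith
  rcases Int.eq_one_or_neg_one_of_mul_eq_neg_one h' with h1 | h1
  · rw [h1] at h'
    omega
  · exact hγ h1

/-- The list `[1, 0, 1, …, 0, 1, γ]` with `n + 1` ones has value `n + 1 + 1/γ`. -/
theorem eWellDef_and_E_one_zero {γ : ℤ} (hγ : γ ≠ 0) (hγ1 : γ ≠ -1) (n : ℕ) :
    EWellDef ((List.range (2 * n + 1)).map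
        (fun i => if i % 2 = 0 then (1 : ℤ) else 0) ++ [γ]) ∧
      E ((List.range (2 * n + 1)).map
        (fun i => if i % 2 = 0 then (1 : ℤ) else 0) ++ [γ]) =
        ((n + 1 : ℕ) * (γ : ℚ) + 1) / γ := by
  have hγQ : (γ : ℚ) ≠ 0 := by exact_mod_cast hγ
  induction n with
  | zero =>
    constructor
    · simp [EWellDef, E, hγ]
    · simp [E]
      field_simp
  | succ n ih =>
    have hlist : (List.range (2 * (n + 1) + 1)).map
        (fun i => if i % 2 = 0 then (1 : ℤ) else 0) ++ [γ] =
        1 :: 0 :: ((List.range (2 * n + 1)).map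
          (fun i => if i % 2 = 0 then (1 : ℤ) else 0) ++ [γ]) := by
      rw [show 2 * (n + 1) + 1 = 2 * n + 1 + 1 + 1 by ring, List.range_succ_eq_map,
        List.range_succ_eq_map]
      simp [Function.comp_def, Nat.add_assoc]
    rw [hlist]
    generalize (List.range (2 * n + 1)).map
      (fun i => if i % 2 = 0 then (1 : ℤ) else 0) ++ [γ] = l at ih
    obtain ⟨hw, hE⟩ := ih
    have hne := natCast_mul_add_one_ne_zero hγ1 (n + 1)
    have hl : E l ≠ 0 := hE ▸ div_ne_zero hne hγQ
    have hz : E (0 :: l) = 1 / E l := by simp [E_cons hw.ne_nil]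
    have hz0 : E (0 :: l) ≠ 0 := hz ▸ one_div_ne_zero hl
    refine ⟨(hw.cons hl 0).cons hz0 1, ?_⟩
    rw [E_cons (by simp), hz, hE]
    push_cast at hne ⊢
    field_simp
    ring

/-- The value of the list of `n` entries `∓2s` with alternating signs, closed by
`±s(γ + 1)`. -/
theorem eWellDef_and_E_alternating_two {γ : ℤ} (hγ1 : γ ≠ -1) (n : ℕ) {s : ℤ} (hs : s * s = 1) :
    EWellDef ((List.range n).map (fun i => s * (2 * (-1 : ℤ) ^ (i + 1))) ++
        [s * ((-1 : ℤ) ^ (n + 1) * (γ + 1))]) ∧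
      E ((List.range n).map (fun i => s * (2 * (-1 : ℤ) ^ (i + 1))) ++
        [s * ((-1 : ℤ) ^ (n + 1) * (γ + 1))]) =
        -s * (((n + 1 : ℕ) * (γ : ℚ) + 1) / (n * γ + 1)) := by
  induction n generalizing s with
  | zero =>
    simp [EWellDef, E]
    ring
  | succ n ih =>
    have hlist : (List.range (n + 1)).map (fun i => s * (2 * (-1 : ℤ) ^ (i + 1))) ++
        [s * ((-1 : ℤ) ^ (n + 1 + 1) * (γ + 1))] =
        (-2 * s) :: ((List.range n).map (fun i => -s * (2 * (-1 : ℤ) ^ (i + 1))) ++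
          [-s * ((-1 : ℤ) ^ (n + 1) * (γ + 1))]) := by
      rw [List.range_succ_eq_map]
      simp [Function.comp_def, pow_succ, mul_comm]
    rw [hlist]
    obtain ⟨hw, hE⟩ := ih (s := -s) (by linarith)
    have hsQ : (s : ℚ) * s = 1 := by exact_mod_cast hs
    have hs0 : (s : ℚ) ≠ 0 := left_ne_zero_of_mul_eq_one hsQ
    have hn := natCast_mul_add_one_ne_zero hγ1 n
    have hn1 := natCast_mul_add_one_ne_zero hγ1 (n + 1)
    generalize (List.range n).map (fun i => -s * (2 * (-1 : ℤ) ^ (i + 1))) ++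
      [-s * ((-1 : ℤ) ^ (n + 1) * (γ + 1))] = l at hw hE
    have hl : E l ≠ 0 := by
      rw [hE]
      push_cast
      rw [neg_neg]
      exact mul_ne_zero hs0 (div_ne_zero (by exact_mod_cast hn1) hn)
    refine ⟨hw.cons hl _, ?_⟩
    rw [E_cons hw.ne_nil, hE]
    push_cast at hn1 ⊢
    field_simp
    linear_combination (-(n : ℚ) * γ - 1) * hsQ

/-- Lemma 22ver: for integers `α, β, γ` with `β > 0`, `γ ≠ 0`,
`γ ≠ −1`, we have `α + 1/(β + 1/γ) = E([α, 1, 0, 1, 0, …, 0, 1, γ])` (with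
`2β−1` alternating entries `1,0,…,0,1` in the middle) and
`α + 1/(β + 1/γ) = E([α+1, −2, 2, −2, …, (−1)^β(γ+1)])` (with middle entries
`m_i = 2·(−1)^i` for `1 ≤ i ≤ β−1`), both values being well defined. -/
theorem lem_two_two (α β γ : ℤ) (hβ : 0 < β) (hγ : γ ≠ 0) (hγ1 : γ ≠ -1) :
    (EWellDef (α :: ((List.range (2 * β.toNat - 1)).map
          (fun i => if i % 2 = 0 then (1 : ℤ) else 0) ++ [γ])) ∧
      (α : ℚ) + 1 / ((β : ℚ) + 1 / (γ : ℚ)) =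
        E (α :: ((List.range (2 * β.toNat - 1)).map
          (fun i => if i % 2 = 0 then (1 : ℤ) else 0) ++ [γ]))) ∧
    (EWellDef ((α + 1) :: ((List.range (β.toNat - 1)).map
          (fun i => 2 * (-1 : ℤ) ^ (i + 1)) ++ [(-1 : ℤ) ^ β.toNat * (γ + 1)])) ∧
      (α : ℚ) + 1 / ((β : ℚ) + 1 / (γ : ℚ)) =
        E ((α + 1) :: ((List.range (β.toNat - 1)).map
          (fun i => 2 * (-1 : ℤ) ^ (i + 1)) ++ [(-1 : ℤ) ^ β.toNat * (γ + 1)]))) := by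
  obtain ⟨n, rfl⟩ : ∃ n : ℕ, β = (n + 1 : ℕ) := ⟨(β - 1).toNat, by omega⟩
  have hγQ : (γ : ℚ) ≠ 0 := by exact_mod_cast hγ
  have hn := natCast_mul_add_one_ne_zero hγ1 n
  have hn1 := natCast_mul_add_one_ne_zero hγ1 (n + 1)
  have hx : ((((n + 1 : ℕ) : ℤ) : ℚ) + 1 / (γ : ℚ)) = ((n + 1 : ℕ) * (γ : ℚ) + 1) / γ := by
    push_cast
    field_simp
  rw [hx, Int.toNat_natCast, show 2 * (n + 1) - 1 = 2 * n + 1 by omega, Nat.add_sub_cancel]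
  obtain ⟨hw, hE⟩ := eWellDef_and_E_one_zero hγ hγ1 n
  obtain ⟨hw', hE'⟩ := eWellDef_and_E_alternating_two hγ1 n (s := 1) (by norm_num)
  simp only [one_mul] at hw' hE'
  refine ⟨⟨hw.cons (hE ▸ div_ne_zero hn1 hγQ) α, by rw [E_cons hw.ne_nil, hE]⟩,
    hw'.cons ?_ _, ?_⟩
  · rw [hE']
    exact mul_ne_zero (by norm_num) (div_ne_zero hn1 hn)
  · rw [E_cons hw'.ne_nil, hE']
    push_cast at hn1 ⊢
    field_simp
    ring
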